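/- Let r ≥ 2 be an integer and let F be a graph satisfying Hypothesis (★). For every ε > 0 there exists n₀ such that for all n ≥ n₀ the following holds for every spectral-extremal graph G for F on n vertices: e(G) ≥ e(T_{n,r}) − ε n², and every partition V(G) = V₁ ∪ … ∪ V_r maximizing the number Σ_{1 ≤ i < j ≤ r} e(V_i, V_j) of edges between distinct parts satisfies Σ_{i=1}^{r} e(G[V_i]) ≤ ε n² and (1/r − 3√ε)·n < |V_i| < (1/r + 3√ε)·n for each i ∈ [r]. -/

import Mathlib

open SimpleGraph

/-- The adjacency matrix of a simple graph over `ℝ`. -/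
noncomputable def adjMat {V : Type*} [Fintype V] (G : SimpleGraph V) : Matrix V V ℝ :=
  letI := Classical.decRel G.Adj
  G.adjMatrix ℝ

/-- The spectral radius of a simple graph: the largest eigenvalue of its adjacency matrix. -/
noncomputable def specRad {V : Type*} [Fintype V] [DecidableEq V] (G : SimpleGraph V) : ℝ :=
  sSup (spectrum ℝ (adjMat G))

/-- The number of edges of a simple graph. -/
noncomputable def eCnt {V : Type*} (G : SimpleGraph V) : ℕ := Nat.card G.edgeSet

/-- `G` contains a copy of `F` (a subgraph isomorphic to `F`). -/
def Contains {W V : Type*} (F : SimpleGraph W) (G : SimpleGraph V) : Prop :=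
  ∃ f : F →g G, Function.Injective f

/-- `G` is `F`-free. -/
def FFree {W V : Type*} (F : SimpleGraph W) (G : SimpleGraph V) : Prop := ¬ Contains F G

/-- The Turán number `ex(n, F)`. -/
noncomputable def exNum {W : Type*} (n : ℕ) (F : SimpleGraph W) : ℕ :=
  sSup {m | ∃ G : SimpleGraph (Fin n), FFree F G ∧ eCnt G = m}

/-- `G` is obtained from the Turán graph `T_{n,r}` by adding `a` edges. -/
def TuranPlus (n r a : ℕ) (G : SimpleGraph (Fin n)) : Prop :=
  (∃ H : SimpleGraph (Fin n), H ≤ G ∧ Nonempty (H ≃g turanGraph n r)) ∧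
    eCnt G = eCnt (turanGraph n r) + a

/-- Hypothesis (★): for all sufficiently large `m`, `ex(m,F) = e(T_{m,r}) + a` and every
extremal graph is obtained from `T_{m,r}` by adding `a` edges. -/
def HypStar {W : Type*} (r a : ℕ) (F : SimpleGraph W) : Prop :=
  ∃ m₀ : ℕ, ∀ m ≥ m₀,
    exNum m F = eCnt (turanGraph m r) + a ∧
    ∀ G : SimpleGraph (Fin m), FFree F G → eCnt G = exNum m F → TuranPlus m r a G

/-- `G` is a spectral-extremal `F`-free graph on its vertex set. -/
def SpecExtremal {W : Type*} (F : SimpleGraph W) {n : ℕ} (G : SimpleGraph (Fin n)) : Prop :=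
  FFree F G ∧ ∀ G' : SimpleGraph (Fin n), FFree F G' → specRad G' ≤ specRad G

/-- Number of edges of `G` joining two distinct parts of the partition `p`. -/
noncomputable def crossCnt {n r : ℕ} (G : SimpleGraph (Fin n)) (p : Fin n → Fin r) : ℕ :=
  Nat.card {e : Sym2 (Fin n) // e ∈ G.edgeSet ∧ ¬ (Sym2.map p e).IsDiag}

/-- Number of edges of `G` inside part `i` of the partition `p`, i.e. `e(G[Vᵢ])`. -/
noncomputable def inCnt {n r : ℕ} (G : SimpleGraph (Fin n)) (p : Fin n → Fin r)
    (i : Fin r) : ℕ :=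
  Nat.card {e : Sym2 (Fin n) // e ∈ G.edgeSet ∧ Sym2.map p e = Sym2.diag i}

/-- The size of part `i` of the partition `p`, i.e. `|Vᵢ|`. -/
noncomputable def partSize {n r : ℕ} (p : Fin n → Fin r) (i : Fin r) : ℕ :=
  Nat.card {v : Fin n // p v = i}

/-- The degree of `v` in `G`. -/
noncomputable def deg {n : ℕ} (G : SimpleGraph (Fin n)) (v : Fin n) : ℕ :=
  Nat.card (G.neighborSet v)

/-- `d_{Vᵢ}(v)`, the number of neighbours of `v` in part `i` of the partition `p`. -/
noncomputable def degIn {n r : ℕ} (G : SimpleGraph (Fin n)) (p : Fin n → Fin r)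
    (i : Fin r) (v : Fin n) : ℕ :=
  Nat.card {w : Fin n // G.Adj v w ∧ p w = i}

/-- The partition `p` into `r` parts maximizes the number of edges between distinct parts,
`∑ eᵢ(Vᵢ) ≤ ε n²`, and each part has size strictly between `(1/r − 3√ε)n` and `(1/r + 3√ε)n`. -/
def GoodPartition (r : ℕ) {n : ℕ} (G : SimpleGraph (Fin n)) (ε : ℝ)
    (p : Fin n → Fin r) : Prop :=
  (∀ q : Fin n → Fin r, crossCnt G q ≤ crossCnt G p) ∧
  (∑ i : Fin r, (inCnt G p i : ℝ)) ≤ ε * n ^ 2 ∧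
  ∀ i : Fin r, (1 / (r : ℝ) - 3 * Real.sqrt ε) * n < partSize p i ∧
    (partSize p i : ℝ) < (1 / (r : ℝ) + 3 * Real.sqrt ε) * n

/-- The set `L` of low-degree vertices. -/
def Lset (r : ℕ) {n : ℕ} (G : SimpleGraph (Fin n)) (ε : ℝ) : Set (Fin n) :=
  {v | (deg G v : ℝ) ≤ (1 - 1 / (r : ℝ) - 3 * r * ε ^ ((1 : ℝ) / 3)) * n}

/-- The set `W` of vertices with many neighbours inside their own part. -/
def Wset {n r : ℕ} (G : SimpleGraph (Fin n)) (p : Fin n → Fin r) (θ : ℝ) : Set (Fin n) :=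
  {v | 2 * θ * n ≤ (degIn G p (p v) v : ℝ)}


section WeightedCliques

open Finset
open scoped Classical

variable {V : Type}

/-- The total weight of the ordered `k`-cliques of `G` inside `S`, where a clique has as weight
the product of the vertex weights `y`. -/
noncomputable def cliqueWeight (G : SimpleGraph V) (y : V → ℝ) : ℕ → Finset V → ℝ
  | 0, _ => 1
  | k + 1, S => ∑ v ∈ S, y v * cliqueWeight G y k {u ∈ S | G.Adj v u}

/-- The total weight of the ordered pairs of adjacent vertices in `S × T`. -/
noncomputable def edgeWeight (G : SimpleGraph V) (y : V → ℝ) (S T : Finset V) : ℝ :=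
  ∑ u ∈ S, ∑ v ∈ T, if G.Adj u v then y u * y v else 0

lemma cliqueWeight_nonneg (G : SimpleGraph V) {y : V → ℝ} (hy : ∀ v, 0 ≤ y v) (k : ℕ)
    (S : Finset V) : 0 ≤ cliqueWeight G y k S := by
  induction k generalizing S with
  | zero => simp [cliqueWeight]
  | succ k ih => exact sum_nonneg fun v _ => mul_nonneg (hy v) (ih _)

lemma cliqueWeight_le_mul (G : SimpleGraph V) {y : V → ℝ} (hy : ∀ v, 0 ≤ y v) {c : ℝ}
    (hc : ∀ v, y v ≤ c) (k : ℕ) (S : Finset V) :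
    cliqueWeight G y k S ≤ c ^ k * cliqueWeight G (fun _ => 1) k S := by
  induction k generalizing S with
  | zero => simp [cliqueWeight]
  | succ k ih =>
    simp only [cliqueWeight, one_mul]
    rw [mul_sum]
    refine sum_le_sum fun v _ => ?_
    calc y v * cliqueWeight G y k {u ∈ S | G.Adj v u}
        ≤ c * (c ^ k * cliqueWeight G (fun _ => 1) k {u ∈ S | G.Adj v u}) :=
          mul_le_mul (hc v) (ih _) (cliqueWeight_nonneg G hy _ _) ((hy v).trans (hc v))
      _ = _ := by ring

lemma edgeWeight_eq_sum_mul (G : SimpleGraph V) (y : V → ℝ) (S T : Finset V) :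
    edgeWeight G y S T = ∑ u ∈ S, y u * ∑ v ∈ T with G.Adj u v, y v := by
  refine sum_congr rfl fun u _ => ?_
  rw [sum_filter, mul_sum]
  exact sum_congr rfl fun v _ => by split_ifs <;> simp

lemma edgeWeight_comm (G : SimpleGraph V) (y : V → ℝ) (S T : Finset V) :
    edgeWeight G y S T = edgeWeight G y T S := by
  unfold edgeWeight
  rw [sum_comm]
  simp_rw [G.adj_comm, mul_comm]

lemma cliqueWeight_two (G : SimpleGraph V) (y : V → ℝ) (S : Finset V) :
    cliqueWeight G y 2 S = edgeWeight G y S S := by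
  rw [edgeWeight_eq_sum_mul]
  simp [cliqueWeight]

lemma edgeWeight_le_sq (G : SimpleGraph V) {y : V → ℝ} (hy : ∀ v, 0 ≤ y v) (S : Finset V) :
    edgeWeight G y S S ≤ (∑ v ∈ S, y v) ^ 2 := by
  rw [sq, sum_mul_sum]
  refine sum_le_sum fun u _ => sum_le_sum fun v _ => ?_
  split_ifs
  · exact le_rfl
  · exact mul_nonneg (hy u) (hy v)

/-- A weighted quantile: a value `D` of `d` such that the elements with `D ≤ d` have weight at
least `η` and those with `D < d` have weight at most `η`. -/
lemma exists_weighted_quantile (S : Finset V) {y : V → ℝ} (d : V → ℝ) {η : ℝ}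
    (hη : 0 < η) (hS : η ≤ ∑ v ∈ S, y v) :
    ∃ D, η ≤ ∑ v ∈ S with D ≤ d v, y v ∧ ∑ v ∈ S with D < d v, y v ≤ η := by
  have hSne : S.Nonempty := by
    by_contra hne
    simp [not_nonempty_iff_eq_empty.1 hne] at hS
    linarith
  let B := {v ∈ S | η ≤ ∑ u ∈ S with d v ≤ d u, y u}
  have hB : B.Nonempty := by
    obtain ⟨m, hm, hmin⟩ := exists_min_image S d hSne
    refine ⟨m, mem_filter.2 ⟨hm, ?_⟩⟩
    rwa [filter_true_of_mem hmin]
  obtain ⟨v, hv, hmax⟩ := exists_max_image B d hB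
  refine ⟨d v, (mem_filter.1 hv).2, ?_⟩
  by_contra! hlt
  have hne : {u ∈ S | d v < d u}.Nonempty := by
    by_contra hne
    rw [not_nonempty_iff_eq_empty.1 hne] at hlt
    simp at hlt
    linarith
  obtain ⟨m, hm, hmin⟩ := exists_min_image _ d hne
  have hm' := mem_filter.1 hm
  have hEq : {u ∈ S | d m ≤ d u} = {u ∈ S | d v < d u} := by
    ext u
    simp only [mem_filter]
    exact ⟨fun h => ⟨h.1, hm'.2.trans_le h.2⟩, fun h => ⟨h.1, hmin u (mem_filter.2 h)⟩⟩
  have : m ∈ B := mem_filter.2 ⟨hm'.1, by rw [hEq]; exact hlt.le⟩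
  exact absurd (hmax m this) (not_le.2 hm'.2)

/-- One step of the symmetrisation: a vertex of almost maximal weighted degree whose
neighbourhood contains few cliques. -/
lemma exists_vertex_few_cliques (G : SimpleGraph V) {y : V → ℝ} (hy : ∀ v, 0 ≤ y v) (k : ℕ)
    (S : Finset V) (hS1 : ∑ v ∈ S, y v ≤ 1) {η δ : ℝ} (hη : 0 < η) (hδ : 0 < δ)
    (hS : η ≤ ∑ v ∈ S, y v) (hcl : cliqueWeight G y (k + 1) S ≤ η * δ / 2) :
    ∃ v : V, cliqueWeight G y k {u ∈ S | G.Adj v u} ≤ δ ∧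
      edgeWeight G y {u ∈ S | ¬ G.Adj v u} S ≤
        (∑ u ∈ S with ¬ G.Adj v u, y u) * (∑ u ∈ S with G.Adj v u, y u) + η := by
  obtain ⟨D, hD1, hD2⟩ := exists_weighted_quantile S (fun v => ∑ u ∈ S with G.Adj v u, y u) hη hS
  have hex : ∃ v ∈ {v ∈ S | D ≤ ∑ u ∈ S with G.Adj v u, y u},
      cliqueWeight G y k {u ∈ S | G.Adj v u} ≤ δ := by
    by_contra! hall
    have : η * δ ≤ cliqueWeight G y (k + 1) S := by
      calc η * δ ≤ (∑ v ∈ S with D ≤ ∑ u ∈ S with G.Adj v u, y u, y v) * δ := by gcongr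
        _ ≤ ∑ v ∈ S with D ≤ ∑ u ∈ S with G.Adj v u, y u,
              y v * cliqueWeight G y k {u ∈ S | G.Adj v u} := by
            rw [sum_mul]
            exact sum_le_sum fun v hv => mul_le_mul_of_nonneg_left (hall v hv).le (hy v)
        _ ≤ _ := sum_le_sum_of_subset_of_nonneg (filter_subset _ _) fun v _ _ =>
            mul_nonneg (hy v) (cliqueWeight_nonneg G hy _ _)
    nlinarith [mul_pos hη hδ]
  obtain ⟨v, hv, hvcl⟩ := hex
  have hvD := (mem_filter.1 hv).2
  refine ⟨v, hvcl, ?_⟩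
  have hpt : ∀ u, y u * ∑ w ∈ S with G.Adj u w, y w ≤
      y u * (∑ w ∈ S with G.Adj v w, y w) +
        if D < ∑ w ∈ S with G.Adj u w, y w then y u else 0 := by
    intro u
    split_ifs with hu
    · have h1 : ∑ w ∈ S with G.Adj u w, y w ≤ 1 :=
        (sum_le_sum_of_subset_of_nonneg (filter_subset _ _) fun v _ _ => hy v).trans hS1
      have h2 : 0 ≤ ∑ w ∈ S with G.Adj v w, y w := sum_nonneg fun v _ => hy v
      nlinarith [mul_nonneg (hy u) h2, hy u]
    · rw [add_zero]
      exact mul_le_mul_of_nonneg_left ((not_lt.1 hu).trans hvD) (hy u)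
  rw [edgeWeight_eq_sum_mul]
  refine (sum_le_sum fun u _ => hpt u).trans ?_
  rw [sum_add_distrib, ← sum_mul]
  gcongr
  refine le_trans ?_ hD2
  rw [← sum_filter, filter_filter]
  refine sum_le_sum_of_subset_of_nonneg (fun u hu => ?_) fun v _ _ => hy v
  rw [mem_filter] at hu ⊢
  exact ⟨hu.1, hu.2.2⟩

lemma edgeWeight_split (G : SimpleGraph V) (y : V → ℝ) (S : Finset V) (P : V → Prop) :
    edgeWeight G y S S + edgeWeight G y {u ∈ S | ¬ P u} {u ∈ S | ¬ P u} =
      2 * edgeWeight G y {u ∈ S | ¬ P u} S + edgeWeight G y {u ∈ S | P u} {u ∈ S | P u} := by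
  have hl : ∀ T, edgeWeight G y S T =
      edgeWeight G y {u ∈ S | P u} T + edgeWeight G y {u ∈ S | ¬ P u} T := fun T =>
    (sum_filter_add_sum_filter_not S P _).symm
  have hr : ∀ T, edgeWeight G y T S =
      edgeWeight G y T {u ∈ S | P u} + edgeWeight G y T {u ∈ S | ¬ P u} := fun T => by
    rw [edgeWeight_comm, hl, edgeWeight_comm, edgeWeight_comm G y _ T]
  rw [hl S, hr, hr, edgeWeight_comm G y {u ∈ S | P u} {u ∈ S | ¬ P u}]
  ring

/-- **Weighted stability.** A weighted graph with few `(k + 2)`-cliques has a partition into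
`k + 1` parts for which the number of edges plus the number of edges inside the parts is at most
the number of edges of the complete multipartite graph, up to a small error. -/
lemma exists_partition_of_few_cliques (k : ℕ) {η : ℝ} (hη : 0 < η) :
    ∃ δ > 0, ∀ (V : Type) (G : SimpleGraph V) (y : V → ℝ) (S : Finset V),
      (∀ v, 0 ≤ y v) → ∑ v ∈ S, y v ≤ 1 → cliqueWeight G y (k + 2) S ≤ δ →
      ∃ p : V → Fin (k + 1),
        edgeWeight G y S S + ∑ i, edgeWeight G y {v ∈ S | p v = i} {v ∈ S | p v = i} ≤
          (∑ v ∈ S, y v) ^ 2 - ∑ i, (∑ v ∈ S with p v = i, y v) ^ 2 + η := by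
  induction k generalizing η with
  | zero =>
    refine ⟨η / 2, by positivity, fun V G y S hy hS1 hcl => ⟨fun _ => 0, ?_⟩⟩
    rw [zero_add, cliqueWeight_two] at hcl
    simp
    linarith
  | succ k ih =>
    obtain ⟨δ, hδ, H⟩ := ih (η := η / 2) (by positivity)
    refine ⟨η / 4 * δ / 2, by positivity, fun V G y S hy hS1 hcl => ?_⟩
    rcases lt_or_ge (∑ v ∈ S, y v) (η / 4) with hlt | hge
    · refine ⟨fun _ => 0, ?_⟩
      have h0 : ∀ i : Fin (k + 1), (0 : Fin (k + 1 + 1)) ≠ i.succ := fun i =>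
        (Fin.succ_ne_zero i).symm
      have := edgeWeight_le_sq G hy S
      have h1 : 0 ≤ ∑ v ∈ S, y v := sum_nonneg fun v _ => hy v
      rw [Fin.sum_univ_succ (n := k + 1), Fin.sum_univ_succ (n := k + 1)]
      simp [h0, edgeWeight] at this ⊢
      nlinarith
    · obtain ⟨v, hvcl, hvE⟩ :=
        exists_vertex_few_cliques G hy (k + 2) S hS1 (by positivity) hδ hge hcl
      obtain ⟨p, hp⟩ := H V G y {u ∈ S | G.Adj v u} hy
        ((sum_le_sum_of_subset_of_nonneg (filter_subset _ _) fun v _ _ => hy v).trans hS1) hvcl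
      refine ⟨fun u => if G.Adj v u then (p u).succ else 0, ?_⟩
      have e0 : {u ∈ S | (if G.Adj v u then (p u).succ else 0) = 0} = {u ∈ S | ¬ G.Adj v u} := by
        refine filter_congr fun u _ => ?_
        split_ifs with h <;> simp [h, Fin.succ_ne_zero]
      have e1 : ∀ i : Fin (k + 1), {u ∈ S | (if G.Adj v u then (p u).succ else 0) = i.succ} =
          {u ∈ {u ∈ S | G.Adj v u} | p u = i} := by
        intro i
        rw [filter_filter]
        refine filter_congr fun u _ => ?_
        split_ifs with h <;> simp [h, (Fin.succ_ne_zero i).symm]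
      rw [Fin.sum_univ_succ (n := k + 1), Fin.sum_univ_succ (n := k + 1)]
      simp only [e0, e1]
      have hsplit := edgeWeight_split G y S (G.Adj v)
      have hw := sum_filter_add_sum_filter_not S (G.Adj v) y
      rw [← hw]
      nlinarith

end WeightedCliques

section CompleteMultipartite

open Finset
open scoped Classical

lemma cliqueWeight_one_eq_sum {V : Type} [Fintype V] (G : SimpleGraph V) (k : ℕ) :
    ∃ (C : Type) (_ : Fintype C) (P : C → Finset V) (g : C → ℝ),
      Fintype.card C = Fintype.card V ^ k ∧ (∀ c, 0 ≤ g c ∧ g c ≤ 1) ∧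
      ∀ S, cliqueWeight G (fun _ => 1) k S = ∑ c, if P c ⊆ S then g c else 0 := by
  induction k with
  | zero => exact ⟨Unit, inferInstance, fun _ => ∅, fun _ => 1, by simp, by simp, by
      simp [cliqueWeight]⟩
  | succ k ih =>
    obtain ⟨C, _, P, g, hC, hg, H⟩ := ih
    refine ⟨V × C, inferInstance, fun x => insert x.1 (P x.2),
      fun x => if ∀ u ∈ P x.2, G.Adj x.1 u then g x.2 else 0, ?_, ?_, ?_⟩
    · rw [Fintype.card_prod, hC, pow_succ, mul_comm]
    · intro x
      dsimp only
      split_ifs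
      · exact hg _
      · simp
    · intro S
      rw [Fintype.sum_prod_type, ← sum_filter_add_sum_filter_not univ (· ∈ S), cliqueWeight]
      rw [sum_eq_zero (s := {x | x ∉ S}), add_zero, filter_mem_eq_inter, univ_inter]
      · refine sum_congr rfl fun v hv => ?_
        rw [H, one_mul]
        refine sum_congr rfl fun c _ => ?_
        have : P c ⊆ {u ∈ S | G.Adj v u} ↔ P c ⊆ S ∧ ∀ u ∈ P c, G.Adj v u := by
          simp only [subset_iff, mem_filter]
          exact ⟨fun h => ⟨fun u hu => (h hu).1, fun u hu => (h hu).2⟩,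
            fun h u hu => ⟨h.1 hu, h.2 u hu⟩⟩
        simp only [this, insert_subset_iff, hv, true_and]
        split_ifs <;> simp_all
      · intro v hv
        refine sum_eq_zero fun c _ => if_neg fun h => ?_
        exact (mem_filter.1 hv).2 (h (mem_insert_self _ _))

lemma choose_ratio_lower_bound {δ : ℝ} (hδ : 0 < δ) (t : ℕ) {n m : ℕ}
    (hn : 4 * t / δ ≤ n) (hm : δ / 2 * n < m + 1) :
    (δ / 4) ^ t * n.choose t ≤ m.choose t := by
  have h1 : ((m + 1 - t : ℕ) : ℝ) ^ t ≤ m.descFactorial t := by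
    exact_mod_cast Nat.pow_sub_le_descFactorial m t
  have h2 : (n.descFactorial t : ℝ) ≤ (n : ℝ) ^ t := by
    exact_mod_cast Nat.descFactorial_le_pow n t
  have h3 : δ / 4 * n ≤ ((m + 1 - t : ℕ) : ℝ) := by
    have : ((m + 1 : ℕ) : ℝ) ≤ ((m + 1 - t : ℕ) : ℝ) + t := by
      exact_mod_cast (by omega : m + 1 ≤ m + 1 - t + t)
    rw [div_le_iff₀ hδ] at hn
    push_cast at this
    linarith
  rw [Nat.descFactorial_eq_factorial_mul_choose] at h1 h2
  have hf : (0 : ℝ) < t.factorial := by exact_mod_cast t.factorial_pos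
  push_cast at h1 h2
  have h4 : (δ / 4) ^ t * (n : ℝ) ^ t ≤ ((m + 1 - t : ℕ) : ℝ) ^ t := by
    rw [← mul_pow]
    gcongr
  have h5 : (δ / 4) ^ t * (t.factorial * n.choose t) ≤ (δ / 4) ^ t * (n : ℝ) ^ t := by gcongr
  have : (t.factorial : ℝ) * ((δ / 4) ^ t * n.choose t) ≤ t.factorial * m.choose t := by linarith
  exact le_of_mul_le_mul_left this hf

lemma choose_ge_linear {d m n t : ℕ} (hd : d ≤ n) :
    (m.choose t : ℝ) * (d - m) ≤ n * d.choose t := by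
  rcases le_total d m with h | h
  · have h1 : (d : ℝ) ≤ m := by exact_mod_cast h
    have : (m.choose t : ℝ) * (d - m) ≤ 0 :=
      mul_nonpos_of_nonneg_of_nonpos (by positivity) (by linarith)
    exact this.trans (by positivity)
  · have h1 : (m.choose t : ℝ) ≤ d.choose t := by exact_mod_cast Nat.choose_le_choose t h
    have h2 : (m : ℝ) ≤ d := by exact_mod_cast h
    have h3 : (d : ℝ) ≤ n := by exact_mod_cast hd
    have h4 : (0 : ℝ) ≤ m := by positivity
    calc (m.choose t : ℝ) * (d - m) ≤ d.choose t * n :=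
          mul_le_mul h1 (by linarith) (by linarith) (by positivity)
      _ = _ := mul_comm _ _

/-- If there are many `(k + 1)`-cliques, some `t` vertices have many `k`-cliques in their common
neighbourhood. -/
lemma exists_set_many_cliques {δ : ℝ} (hδ : 0 < δ) (k t : ℕ) :
    ∃ δ' > 0, ∃ n₀ : ℕ, ∀ (V : Type) [Fintype V] (G : SimpleGraph V) (S : Finset V),
      n₀ ≤ Fintype.card V →
      δ * (Fintype.card V : ℝ) ^ (k + 1) ≤ cliqueWeight G (fun _ => 1) (k + 1) S →
      ∃ T ⊆ S, #T = t ∧ δ' * (Fintype.card V : ℝ) ^ k ≤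
        cliqueWeight G (fun _ => 1) k {v ∈ S | ∀ u ∈ T, G.Adj u v} := by
  refine ⟨δ / 2 * (δ / 4) ^ t, by positivity, ⌈4 * t / δ⌉₊ + t + 1, fun V _ G S hn hcl => ?_⟩
  obtain ⟨C, _, P, g, hC, hg, H⟩ := cliqueWeight_one_eq_sum G k
  set n := Fintype.card V with hndef
  have hn1 : (4 * t / δ : ℝ) ≤ n := (Nat.le_ceil _).trans (Nat.cast_le.2 (by omega))
  have hnpos : (0 : ℝ) < n := by exact_mod_cast (by omega)
  set m := ⌊δ / 2 * n⌋₊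
  have hm1 : δ / 2 * n < m + 1 := Nat.lt_floor_add_one _
  have hm2 : (m : ℝ) ≤ δ / 2 * n := Nat.floor_le (by positivity)
  have hch := choose_ratio_lower_bound hδ t hn1 hm1
  let h : C → ℝ := fun c => if P c ⊆ S then g c else 0
  have hh : ∀ c, 0 ≤ h c ∧ h c ≤ 1 := fun c => by
    simp only [h]; split_ifs
    · exact hg c
    · simp
  let D : C → Finset V := fun c => {v ∈ S | ∀ u ∈ P c, G.Adj v u}
  have hcount : cliqueWeight G (fun _ => 1) (k + 1) S = ∑ c, h c * #(D c) := by
    simp only [cliqueWeight, one_mul, H]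
    rw [sum_comm]
    refine sum_congr rfl fun c _ => ?_
    have : ∀ v, P c ⊆ {u ∈ S | G.Adj v u} ↔ P c ⊆ S ∧ ∀ u ∈ P c, G.Adj v u := fun v => by
      simp only [subset_iff, mem_filter]
      exact ⟨fun h => ⟨fun u hu => (h hu).1, fun u hu => (h hu).2⟩,
        fun h u hu => ⟨h.1 hu, h.2 u hu⟩⟩
    simp only [this, h, D]
    by_cases hP : P c ⊆ S
    · simp [hP, ← sum_filter, mul_comm]
    · simp [hP]
  have hcountT : ∑ T ∈ powersetCard t S,
      cliqueWeight G (fun _ => 1) k {v ∈ S | ∀ u ∈ T, G.Adj u v} =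
        ∑ c, h c * (#(D c)).choose t := by
    simp only [H]
    rw [sum_comm]
    refine sum_congr rfl fun c _ => ?_
    by_cases hP : P c ⊆ S
    · have e : ∀ T ∈ powersetCard t S,
          (if P c ⊆ {v ∈ S | ∀ u ∈ T, G.Adj u v} then g c else 0) =
            if T ⊆ D c then g c else 0 := by
        intro T hT
        have hTS := (mem_powersetCard.1 hT).1
        congr 1
        simp only [subset_iff, mem_filter, D, eq_iff_iff]
        exact ⟨fun a u hu => ⟨hTS hu, fun w hw => (a hw).2 u hu⟩,
          fun a w hw => ⟨hP hw, fun u hu => (a hu).2 w hw⟩⟩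
      rw [sum_congr rfl e, ← sum_filter]
      have e2 : {T ∈ powersetCard t S | T ⊆ D c} = powersetCard t (D c) := by
        ext T
        simp only [mem_filter, mem_powersetCard]
        exact ⟨fun a => ⟨a.2, a.1.2⟩, fun a => ⟨⟨a.1.trans (filter_subset _ _), a.2⟩, a.1⟩⟩
      rw [e2, sum_const, card_powersetCard]
      simp [h, hP, mul_comm]
    · have e : ∀ T : Finset V, ¬ P c ⊆ {v ∈ S | ∀ u ∈ T, G.Adj u v} := fun T a =>
        hP (a.trans (filter_subset _ _))
      simp [h, hP, e]
  have hsum : (m.choose t : ℝ) * (δ / 2 * n ^ k) ≤ ∑ c, h c * (#(D c)).choose t := by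
    have h1 : (m.choose t : ℝ) * (∑ c, h c * #(D c) - m * ∑ c, h c) ≤
        n * ∑ c, h c * (#(D c)).choose t := by
      rw [mul_sum, ← sum_sub_distrib, mul_sum, mul_sum]
      refine sum_le_sum fun c _ => ?_
      have := mul_le_mul_of_nonneg_left
        (choose_ge_linear (m := m) (t := t) (card_le_univ (D c))) (hh c).1
      linarith
    have h2 : ∑ c, h c ≤ (n : ℝ) ^ k := by
      refine (sum_le_sum fun c _ => (hh c).2).trans ?_
      simp [hC]
    have h3 : (m : ℝ) * ∑ c, h c ≤ δ / 2 * n * n ^ k :=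
      mul_le_mul hm2 h2 (sum_nonneg fun c _ => (hh c).1) (by positivity)
    have h4 : (m.choose t : ℝ) * (n * (δ / 2 * n ^ k)) ≤
        m.choose t * (∑ c, h c * #(D c) - m * ∑ c, h c) := by
      gcongr
      rw [← hcount]
      rw [pow_succ] at hcl
      linarith
    have h5 : (n : ℝ) * (m.choose t * (δ / 2 * n ^ k)) ≤ n * ∑ c, h c * (#(D c)).choose t := by
      linarith
    exact le_of_mul_le_mul_left h5 hnpos
  rw [← hcountT] at hsum
  have hnt : 0 < n.choose t := Nat.choose_pos (by omega)
  by_contra! hcon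
  have hmpos : (0 : ℝ) < m.choose t := lt_of_lt_of_le (by positivity) hch
  have hne : (powersetCard t S).Nonempty := by
    by_contra hne
    rw [not_nonempty_iff_eq_empty.1 hne, sum_empty] at hsum
    exact absurd hsum (not_le.2 (by positivity))
  have hlt := sum_lt_sum_of_nonempty hne fun T hT =>
    hcon T (mem_powersetCard.1 hT).1 (mem_powersetCard.1 hT).2
  rw [sum_const, card_powersetCard, nsmul_eq_mul] at hlt
  have hSn : ((#S).choose t : ℝ) ≤ n.choose t := by
    exact_mod_cast Nat.choose_le_choose t (card_le_univ S)
  have : ((#S).choose t : ℝ) * (δ / 2 * (δ / 4) ^ t * n ^ k) ≤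
      m.choose t * (δ / 2 * n ^ k) := by
    calc ((#S).choose t : ℝ) * (δ / 2 * (δ / 4) ^ t * n ^ k)
        ≤ n.choose t * (δ / 2 * (δ / 4) ^ t * n ^ k) := by gcongr
      _ = ((δ / 4) ^ t * n.choose t) * (δ / 2 * n ^ k) := by ring
      _ ≤ _ := by gcongr
  linarith

/-- A graph with a positive density of `k`-cliques contains a complete `k`-partite graph with
parts of size `t`. -/
lemma exists_completeMultipartite (k : ℕ) {δ : ℝ} (hδ : 0 < δ) (t : ℕ) :
    ∃ n₀ : ℕ, ∀ (V : Type) [Fintype V] (G : SimpleGraph V) (S : Finset V),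
      n₀ ≤ Fintype.card V →
      δ * (Fintype.card V : ℝ) ^ k ≤ cliqueWeight G (fun _ => 1) k S →
      ∃ T : Fin k → Finset V, (∀ i, T i ⊆ S ∧ #(T i) = t) ∧
        ∀ i j, i ≠ j → ∀ u ∈ T i, ∀ v ∈ T j, G.Adj u v := by
  induction k generalizing δ with
  | zero => exact ⟨0, fun V _ G S _ _ => ⟨Fin.elim0, fun i => i.elim0, fun i => i.elim0⟩⟩
  | succ k ih =>
    obtain ⟨δ', hδ', n₁, H₁⟩ := exists_set_many_cliques hδ k t
    obtain ⟨n₂, H₂⟩ := ih hδ'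
    refine ⟨max n₁ n₂, fun V _ G S hn hcl => ?_⟩
    obtain ⟨T₀, hT₀, hT₀c, hcl'⟩ := H₁ V G S (le_of_max_le_left hn) hcl
    obtain ⟨T, hT, hadj⟩ := H₂ V G _ (le_of_max_le_right hn) hcl'
    have hcross : ∀ i, ∀ u ∈ T₀, ∀ v ∈ T i, G.Adj u v := fun i u hu v hv =>
      (mem_filter.1 ((hT i).1 hv)).2 u hu
    refine ⟨Fin.cons T₀ T, fun i => ?_, fun i j => ?_⟩
    · refine Fin.cases ⟨hT₀, hT₀c⟩ (fun i => ?_) i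
      exact ⟨(hT i).1.trans (filter_subset _ _), (hT i).2⟩
    · refine Fin.cases ?_ (fun i => ?_) i <;> refine Fin.cases ?_ (fun j => ?_) j
      · exact fun h => absurd rfl h
      · exact fun _ u hu v hv => hcross j u hu v hv
      · exact fun _ u hu v hv => (hcross i v hv u hu).symm
      · exact fun h => hadj i j fun e => h (by rw [e])

/-- An `F`-free graph has few `k`-cliques if `F` is `k`-colourable. -/
lemma cliqueWeight_lt_of_FFree {W : Type*} [Finite W] {F : SimpleGraph W} {k : ℕ}
    (hF : F.Colorable k) {δ : ℝ} (hδ : 0 < δ) :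
    ∃ n₀ : ℕ, ∀ (V : Type) [Fintype V] (G : SimpleGraph V) (S : Finset V),
      n₀ ≤ Fintype.card V → FFree F G →
      cliqueWeight G (fun _ => 1) k S < δ * (Fintype.card V : ℝ) ^ k := by
  have := Fintype.ofFinite W
  obtain ⟨col⟩ := hF
  obtain ⟨n₀, H⟩ := exists_completeMultipartite k hδ (Fintype.card W)
  refine ⟨n₀, fun V _ G S hn hfree => ?_⟩
  by_contra! hcl
  obtain ⟨T, hT, hadj⟩ := H V G S hn hcl
  have hemb : ∀ i, ∃ f : W → V, Function.Injective f ∧ ∀ w, f w ∈ T i := fun i => by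
    have e : W ≃ T i := Fintype.equivOfCardEq (by simp [(hT i).2])
    exact ⟨fun w => e w, Subtype.val_injective.comp e.injective, fun w => (e w).2⟩
  choose f hf hfT using hemb
  refine hfree ⟨⟨fun w => f (col w) w, fun {a b} hab => ?_⟩, fun a b hab => ?_⟩
  · exact hadj _ _ (col.valid hab) _ (hfT _ _) _ (hfT _ _)
  · change f (col a) a = f (col b) b at hab
    by_cases hc : col a = col b
    · rw [hc] at hab
      exact hf _ hab
    · have := hadj _ _ hc _ (hfT (col a) a) _ (hfT (col b) b)
      rw [hab] at this
      exact absurd this (G.loopless.irrefl _)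

end CompleteMultipartite

section SpectralRadius

open Finset
open scoped Classical Matrix

variable {V : Type} [Fintype V]

lemma adjMat_apply (G : SimpleGraph V) (u v : V) :
    adjMat G u v = if G.Adj u v then 1 else 0 := by
  simp [adjMat, SimpleGraph.adjMatrix_apply]

lemma adjMat_isHermitian (G : SimpleGraph V) : (adjMat G).IsHermitian := by
  ext u v
  simp [adjMat_apply, G.adj_comm]

lemma spectrum_adjMat_finite [DecidableEq V] (G : SimpleGraph V) :
    (spectrum ℝ (adjMat G)).Finite := by
  rw [(adjMat_isHermitian G).spectrum_real_eq_range_eigenvalues]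
  exact Set.finite_range _

lemma exists_eigenvector_specRad [DecidableEq V] [Nonempty V] (G : SimpleGraph V) :
    ∃ x : V → ℝ, ∑ v, x v ^ 2 = 1 ∧ adjMat G *ᵥ x = specRad G • x := by
  have hA := adjMat_isHermitian G
  have hmem : specRad G ∈ spectrum ℝ (adjMat G) := by
    refine Set.Nonempty.csSup_mem ?_ (spectrum_adjMat_finite G)
    rw [hA.spectrum_real_eq_range_eigenvalues]
    exact Set.range_nonempty _
  rw [hA.spectrum_real_eq_range_eigenvalues] at hmem
  obtain ⟨i, hi⟩ := hmem
  refine ⟨hA.eigenvectorBasis i, ?_, ?_⟩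
  · have h1 := hA.eigenvectorBasis.orthonormal.1 i
    rw [EuclideanSpace.norm_eq, Real.sqrt_eq_one] at h1
    simpa using h1
  · rw [hA.mulVec_eigenvectorBasis, hi]

lemma sum_adj_le_specRad_mul [DecidableEq V] (G : SimpleGraph V) :
    ∑ u, ∑ v, (if G.Adj u v then (1 : ℝ) else 0) ≤ specRad G * Fintype.card V := by
  have hA := adjMat_isHermitian G
  have hB : (algebraMap ℝ (Matrix V V ℝ) (specRad G) - adjMat G).IsHermitian := by
    refine Matrix.IsHermitian.sub ?_ hA
    rw [Matrix.algebraMap_eq_diagonal]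
    exact Matrix.isHermitian_diagonal _
  have hpsd : (algebraMap ℝ (Matrix V V ℝ) (specRad G) - adjMat G).PosSemidef := by
    rw [hB.posSemidef_iff_eigenvalues_nonneg]
    intro i
    have hi : hB.eigenvalues i ∈
        spectrum ℝ (algebraMap ℝ (Matrix V V ℝ) (specRad G) - adjMat G) := by
      rw [hB.spectrum_real_eq_range_eigenvalues]
      exact Set.mem_range_self i
    rw [← spectrum.singleton_sub_eq] at hi
    obtain ⟨a, ha, b, hb, hab⟩ := hi
    rw [Set.mem_singleton_iff] at ha
    have := le_csSup (spectrum_adjMat_finite G).bddAbove hb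
    simp only [Pi.zero_apply, ← hab, ha]
    exact sub_nonneg.2 this
  have h := hpsd.dotProduct_mulVec_nonneg (fun _ => 1)
  rw [Matrix.sub_mulVec, dotProduct_sub] at h
  simp [dotProduct, Matrix.mulVec, Matrix.algebraMap_matrix_apply, adjMat_apply] at h
  have e : ∑ u, ∑ v, (if G.Adj u v then (1 : ℝ) else 0) =
      ∑ x, ((#{v | G.Adj x v} : ℕ) : ℝ) := by simp
  rw [e]
  linarith

/-- Nikiforov's inequality: the square of the spectral radius is bounded by the number of ordered
pairs of adjacent vertices times the value at some bounded weight of the Lagrangian form. -/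
lemma exists_weight_specRad_sq_le [DecidableEq V] [Nonempty V] (G : SimpleGraph V)
    (hpos : 0 < specRad G) :
    ∃ y : V → ℝ, (∀ v, 0 ≤ y v) ∧ ∑ v, y v = 1 ∧
      (∀ v, y v ≤ Fintype.card V / specRad G ^ 2) ∧
      specRad G ^ 2 ≤ (∑ u, ∑ v, (if G.Adj u v then (1 : ℝ) else 0)) *
        edgeWeight G y univ univ := by
  obtain ⟨x, hx1, hx⟩ := exists_eigenvector_specRad G
  have hxv : ∀ u, specRad G * x u = ∑ v, (if G.Adj u v then (1 : ℝ) else 0) * x v := fun u => by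
    have := congrFun hx u
    simp only [Matrix.mulVec, dotProduct, adjMat_apply, Pi.smul_apply, smul_eq_mul] at this
    exact this.symm
  refine ⟨fun v => x v ^ 2, fun v => sq_nonneg _, hx1, fun u => ?_, ?_⟩
  · rw [le_div_iff₀ (by positivity), ← mul_pow, mul_comm, hxv]
    refine (sum_mul_sq_le_sq_mul_sq _ _ _).trans ?_
    rw [hx1, mul_one]
    refine (sum_le_sum fun v _ => (?_ : _ ≤ (1 : ℝ))).trans (by simp)
    split_ifs <;> norm_num
  · have h1 : specRad G = ∑ q : V × V, (if G.Adj q.1 q.2 then (1 : ℝ) else 0) *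
        ((if G.Adj q.1 q.2 then 1 else 0) * (x q.1 * x q.2)) := by
      rw [Fintype.sum_prod_type]
      calc specRad G = specRad G * ∑ u, x u ^ 2 := by rw [hx1, mul_one]
        _ = ∑ u, x u * (specRad G * x u) := by
            rw [mul_sum]
            exact sum_congr rfl fun u _ => by ring
        _ = _ := by
            refine sum_congr rfl fun u _ => ?_
            rw [hxv, mul_sum]
            exact sum_congr rfl fun v _ => by split_ifs <;> ring
    calc specRad G ^ 2 = _ := by rw [h1]
      _ ≤ _ := sum_mul_sq_le_sq_mul_sq _ _ _
      _ = _ := by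
        rw [Fintype.sum_prod_type, Fintype.sum_prod_type]
        congr 1
        · exact sum_congr rfl fun u _ => sum_congr rfl fun v _ => by split_ifs <;> norm_num
        · exact sum_congr rfl fun u _ => sum_congr rfl fun v _ => by split_ifs <;> ring

end SpectralRadius

section Counting

open Finset
open scoped Classical

lemma two_mul_eCnt {V : Type} [Fintype V] (G : SimpleGraph V) :
    2 * (eCnt G : ℝ) = ∑ u, ∑ v, if G.Adj u v then (1 : ℝ) else 0 := by
  have h := G.sum_degrees_eq_twice_card_edges
  rw [eCnt, Nat.card_eq_fintype_card, ← SimpleGraph.edgeFinset_card]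
  have h' : (∑ v, (G.degree v : ℝ)) = 2 * #G.edgeFinset := by exact_mod_cast h
  rw [← h']
  refine sum_congr rfl fun u _ => ?_
  rw [← G.card_neighborFinset_eq_degree, G.neighborFinset_eq_filter]
  simp

lemma two_mul_crossCnt {n r : ℕ} (G : SimpleGraph (Fin n)) (p : Fin n → Fin r) :
    2 * (crossCnt G p : ℝ) = ∑ u, ∑ v, if G.Adj u v ∧ p u ≠ p v then (1 : ℝ) else 0 := by
  let H : SimpleGraph (Fin n) :=
    { Adj := fun u v => G.Adj u v ∧ p u ≠ p v
      symm := ⟨fun u v h => ⟨h.1.symm, h.2.symm⟩⟩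
      loopless := ⟨fun u h => h.2 rfl⟩ }
  have : crossCnt G p = eCnt H := by
    refine Nat.card_congr (Equiv.subtypeEquivRight fun e => ?_)
    induction e with
    | h u v => simp [H]
  rw [this, two_mul_eCnt]
  exact sum_congr rfl fun u _ => sum_congr rfl fun v _ => by congr

lemma two_mul_inCnt {n r : ℕ} (G : SimpleGraph (Fin n)) (p : Fin n → Fin r) (i : Fin r) :
    2 * (inCnt G p i : ℝ) =
      ∑ u, ∑ v, if G.Adj u v ∧ p u = i ∧ p v = i then (1 : ℝ) else 0 := by
  let H : SimpleGraph (Fin n) :=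
    { Adj := fun u v => G.Adj u v ∧ p u = i ∧ p v = i
      symm := ⟨fun u v h => ⟨h.1.symm, h.2.2, h.2.1⟩⟩
      loopless := ⟨fun u h => G.loopless.irrefl u h.1⟩ }
  have : inCnt G p i = eCnt H := by
    refine Nat.card_congr (Equiv.subtypeEquivRight fun e => ?_)
    induction e with
    | h u v => simp [H, Sym2.diag]
  rw [this, two_mul_eCnt]
  exact sum_congr rfl fun u _ => sum_congr rfl fun v _ => by congr

lemma crossCnt_add_sum_inCnt {n r : ℕ} (G : SimpleGraph (Fin n)) (p : Fin n → Fin r) :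
    (crossCnt G p : ℝ) + ∑ i, (inCnt G p i : ℝ) = eCnt G := by
  have h : 2 * (crossCnt G p : ℝ) + ∑ i, 2 * (inCnt G p i : ℝ) = 2 * eCnt G := by
    simp_rw [two_mul_crossCnt, two_mul_inCnt, two_mul_eCnt]
    rw [sum_comm (s := (univ : Finset (Fin r))), ← sum_add_distrib]
    refine sum_congr rfl fun u _ => ?_
    rw [sum_comm (s := (univ : Finset (Fin r))), ← sum_add_distrib]
    refine sum_congr rfl fun v _ => ?_
    by_cases hadj : G.Adj u v <;> by_cases hp : p u = p v <;> simp [hadj, hp]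
    exact fun h => hp h.symm
  rw [← mul_sum] at h
  linarith

lemma partSize_eq_card {n r : ℕ} (p : Fin n → Fin r) (i : Fin r) :
    partSize p i = #{v | p v = i} := by
  rw [partSize, Nat.card_eq_fintype_card, Fintype.card_subtype]

lemma sum_partSize {n r : ℕ} (p : Fin n → Fin r) : ∑ i, (partSize p i : ℝ) = n := by
  simp_rw [partSize_eq_card]
  have := card_eq_sum_card_fiberwise (s := univ) (t := univ) (f := p) (by simp)
  rw [card_univ, Fintype.card_fin] at this
  exact_mod_cast this.symm

lemma two_mul_crossCnt_le {n r : ℕ} (G : SimpleGraph (Fin n)) (p : Fin n → Fin r) :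
    2 * (crossCnt G p : ℝ) ≤ n ^ 2 - ∑ i, (partSize p i : ℝ) ^ 2 := by
  have h : ∑ i, (partSize p i : ℝ) ^ 2 = ∑ u, ∑ v, if p u = p v then (1 : ℝ) else 0 := by
    have h1 : ∀ i, (partSize p i : ℝ) ^ 2 =
        ∑ u, ∑ v, if p u = i ∧ p v = i then (1 : ℝ) else 0 := fun i => by
      have : (partSize p i : ℝ) = ∑ u, if p u = i then (1 : ℝ) else 0 := by
        simp [partSize_eq_card]
      rw [this, sq, sum_mul_sum]
      refine sum_congr rfl fun u _ => sum_congr rfl fun v _ => ?_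
      by_cases h1 : p u = i <;> by_cases h2 : p v = i <;> simp [h1, h2]
    simp_rw [h1]
    rw [sum_comm]
    refine sum_congr rfl fun u _ => ?_
    rw [sum_comm]
    refine sum_congr rfl fun v _ => ?_
    by_cases hp : p u = p v <;> simp [hp]
    exact fun h => hp h.symm
  have hn : (n : ℝ) ^ 2 = ∑ _u : Fin n, ∑ _v : Fin n, (1 : ℝ) := by simp [sq]
  rw [h, hn, two_mul_crossCnt, ← sum_sub_distrib]
  refine sum_le_sum fun u _ => ?_
  rw [← sum_sub_distrib]
  refine sum_le_sum fun v _ => ?_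
  by_cases h1 : G.Adj u v <;> by_cases h2 : p u = p v <;> simp [h1, h2]

end Counting

section Turan

lemma two_mul_eCnt_turanGraph_le (n : ℕ) {r : ℕ} (hr : 1 ≤ r) :
    2 * r * (eCnt (turanGraph n r) : ℝ) ≤ (r - 1) * (n : ℝ) ^ 2 := by
  have h := mul_card_edgeFinset_turanGraph_le (n := n) (r := r)
  rw [eCnt, Nat.card_eq_fintype_card, ← SimpleGraph.edgeFinset_card]
  have h' : ((2 * r * (turanGraph n r).edgeFinset.card : ℕ) : ℝ) ≤
      ((r - 1) * n ^ 2 : ℕ) := by exact_mod_cast h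
  push_cast [Nat.cast_sub hr] at h'
  exact h'

lemma le_two_mul_eCnt_turanGraph (n : ℕ) {r : ℕ} (hr : 1 ≤ r) :
    (r - 1) * (n : ℝ) ^ 2 - r ^ 3 ≤ 2 * r * (eCnt (turanGraph n r) : ℝ) := by
  have hr' : (1 : ℝ) ≤ r := by exact_mod_cast hr
  rw [eCnt, Nat.card_eq_fintype_card, ← SimpleGraph.edgeFinset_card]
  induction n using Nat.strong_induction_on with
  | _ n ih =>
    rcases lt_or_ge n r with hlt | hge
    · have : (n : ℝ) ≤ r := by exact_mod_cast hlt.le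
      have h2 : (n : ℝ) ^ 2 ≤ (r : ℝ) ^ 2 := by gcongr
      have h3 : (0 : ℝ) ≤ 2 * r * ((turanGraph n r).edgeFinset.card : ℝ) := by positivity
      nlinarith
    · obtain ⟨m, rfl⟩ := Nat.exists_eq_add_of_le' hge
      have := ih m (by omega)
      rw [card_edgeFinset_turanGraph_add]
      push_cast [Nat.cast_sub hr, Nat.cast_choose_two]
      nlinarith

end Turan

section Hypothesis

lemma bddAbove_eCnt_FFree {W : Type*} (F : SimpleGraph W) (n : ℕ) :
    BddAbove {m | ∃ G : SimpleGraph (Fin n), FFree F G ∧ eCnt G = m} := by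
  refine ⟨Nat.card (Sym2 (Fin n)), ?_⟩
  rintro m ⟨G, _, rfl⟩
  exact Nat.card_le_card_of_injective _ Subtype.val_injective

/-- Under the hypothesis, `F` is a finite `(r + 1)`-colourable graph. -/
lemma finite_and_colorable_of_hypStar {W : Type*} {r a : ℕ} (hr : 1 ≤ r) {F : SimpleGraph W}
    (h : HypStar r a F) : Finite W ∧ F.Colorable (r + 1) := by
  obtain ⟨m₀, hm₀⟩ := h
  by_contra hcon
  have hfree : ∀ m, FFree F (turanGraph m (r + 1)) := by
    rintro m ⟨f, hf⟩
    refine hcon ⟨Finite.of_injective f hf, ⟨Coloring.mk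
      (fun w => (⟨(f w : ℕ) % (r + 1), Nat.mod_lt _ (by omega)⟩ : Fin (r + 1))) ?_⟩⟩
    intro u v huv heq
    exact turanGraph_adj.1 (f.map_adj huv) (Fin.mk.inj_iff.1 heq)
  set m := r * (r + 1) ^ 3 + 2 * r * (r + 1) * a + 1 + m₀ with hm
  have hle : eCnt (turanGraph m (r + 1)) ≤ eCnt (turanGraph m r) + a := by
    rw [← (hm₀ m (by omega)).1]
    exact le_csSup (bddAbove_eCnt_FFree F m) ⟨_, hfree m, rfl⟩
  have hle' : (eCnt (turanGraph m (r + 1)) : ℝ) ≤ eCnt (turanGraph m r) + a := by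
    exact_mod_cast hle
  have h1 := le_two_mul_eCnt_turanGraph m (r := r + 1) (by omega)
  have h2 := two_mul_eCnt_turanGraph_le m hr
  push_cast at h1
  have hr0 : (0 : ℝ) ≤ r := by positivity
  have hmge : (r * (r + 1) ^ 3 + 2 * r * (r + 1) * a + 1 : ℝ) ≤ m := by
    rw [hm]; push_cast; linarith [(Nat.cast_nonneg m₀ : (0 : ℝ) ≤ m₀)]
  have hm1 : (1 : ℝ) ≤ m := by
    have : (0 : ℝ) ≤ r * (r + 1) ^ 3 + 2 * r * (r + 1) * a := by positivity
    linarith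
  have hmsq : (m : ℝ) ≤ (m : ℝ) ^ 2 := by nlinarith
  have h3 := mul_le_mul_of_nonneg_left h1 hr0
  have h4 := mul_le_mul_of_nonneg_left h2 (by positivity : (0 : ℝ) ≤ r + 1)
  have h5 := mul_le_mul_of_nonneg_left hle' (by positivity : (0 : ℝ) ≤ 2 * r * (r + 1))
  nlinarith

/-- Under the hypothesis, a spectral-extremal graph has spectral radius at least the average degree
of the Turán graph. -/
lemma specRad_ge_of_specExtremal {W : Type*} {r a : ℕ} (hr : 2 ≤ r) {F : SimpleGraph W}
    (h : HypStar r a F) : ∃ n₀ : ℕ, ∀ n ≥ n₀, ∀ G : SimpleGraph (Fin n), SpecExtremal F G →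
      2 * (eCnt (turanGraph n r) : ℝ) ≤ specRad G * n := by
  obtain ⟨m₀, hm₀⟩ := h
  refine ⟨m₀ + r ^ 3 + 1, fun n hn G hG => ?_⟩
  have hex := (hm₀ n (by omega)).1
  have hr' : (2 : ℝ) ≤ r := by exact_mod_cast hr
  have hTpos : 0 < eCnt (turanGraph n r) := by
    have h1 := le_two_mul_eCnt_turanGraph n (r := r) (by omega)
    have hn' : (r : ℝ) ^ 3 + 1 ≤ n := by exact_mod_cast (by omega : r ^ 3 + 1 ≤ n)
    have hr3 : (0 : ℝ) ≤ (r : ℝ) ^ 3 := by positivity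
    have : 0 < 2 * (r : ℝ) * (eCnt (turanGraph n r) : ℝ) := by nlinarith
    by_contra h0
    rw [Nat.eq_zero_of_not_pos h0] at this
    simp at this
  have hne : {m | ∃ G : SimpleGraph (Fin n), FFree F G ∧ eCnt G = m}.Nonempty := by
    by_contra hne
    rw [exNum, Set.not_nonempty_iff_eq_empty.1 hne, csSup_empty] at hex
    simp at hex
    omega
  obtain ⟨G', hG', hcnt⟩ := Nat.sSup_mem hne (bddAbove_eCnt_FFree F n)
  have h1 := sum_adj_le_specRad_mul G'
  have h2 := hG.2 G' hG'
  have h3 : eCnt (turanGraph n r) ≤ eCnt G' := by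
    rw [hcnt]
    change _ ≤ exNum n F
    omega
  have h3' : (eCnt (turanGraph n r) : ℝ) ≤ eCnt G' := by exact_mod_cast h3
  rw [← two_mul_eCnt, Fintype.card_fin] at h1
  have h4 : specRad G' * n ≤ specRad G * n := by gcongr
  linarith

end Hypothesis

section Main

open Finset
open scoped Classical

lemma one_div_le_sum_sq {r : ℕ} (hr : 0 < r) (w : Fin r → ℝ) (hw : ∑ i, w i = 1) :
    1 / (r : ℝ) ≤ ∑ i, w i ^ 2 := by
  have h := sq_sum_le_card_mul_sum_sq (s := univ) (f := w)
  rw [hw, card_univ, Fintype.card_fin, one_pow] at h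
  rw [div_le_iff₀ (by exact_mod_cast hr)]
  linarith

lemma edgeWeight_nonneg {V : Type} (G : SimpleGraph V) {y : V → ℝ} (hy : ∀ v, 0 ≤ y v)
    (S T : Finset V) : 0 ≤ edgeWeight G y S T :=
  sum_nonneg fun u _ => sum_nonneg fun v _ => by
    split_ifs
    · exact mul_nonneg (hy u) (hy v)
    · exact le_rfl

/-- In a large `F`-free graph, every spread-out weight admits a partition as in
`exists_partition_of_few_cliques`. -/
lemma exists_partition_of_FFree {W : Type*} [Finite W] {F : SimpleGraph W} {r : ℕ} (hr : 1 ≤ r)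
    (hF : F.Colorable (r + 1)) {η : ℝ} (hη : 0 < η) :
    ∃ n₀ : ℕ, ∀ n ≥ n₀, ∀ G : SimpleGraph (Fin n), FFree F G → ∀ y : Fin n → ℝ,
      (∀ v, 0 ≤ y v) → ∑ v, y v = 1 → (∀ v, y v ≤ 9 / n) →
      ∃ p : Fin n → Fin r, edgeWeight G y univ univ +
        ∑ i, edgeWeight G y {v | p v = i} {v | p v = i} ≤ 1 - 1 / r + η := by
  obtain ⟨k, rfl⟩ := Nat.exists_eq_add_of_le' hr
  obtain ⟨δ, hδ, H⟩ := exists_partition_of_few_cliques k hη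
  obtain ⟨n₀, hn₀⟩ := cliqueWeight_lt_of_FFree hF (δ := δ / 9 ^ (k + 2)) (by positivity)
  refine ⟨n₀ + 1, fun n hn G hG y hy hy1 hyn => ?_⟩
  have hnpos : (0 : ℝ) < n := by exact_mod_cast (by omega)
  have hcl : cliqueWeight G y (k + 2) univ ≤ δ := by
    have h1 := hn₀ (Fin n) G univ (by rw [Fintype.card_fin]; omega) hG
    rw [Fintype.card_fin] at h1
    calc cliqueWeight G y (k + 2) univ
        ≤ (9 / n) ^ (k + 2) * cliqueWeight G (fun _ => 1) (k + 2) univ :=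
          cliqueWeight_le_mul G hy hyn _ _
      _ ≤ (9 / n) ^ (k + 2) * (δ / 9 ^ (k + 2) * n ^ (k + 2)) := by gcongr
      _ = δ := by rw [div_pow]; field_simp
  obtain ⟨p, hp⟩ := H (Fin n) G y univ hy hy1.le hcl
  refine ⟨p, hp.trans ?_⟩
  rw [hy1]
  have := one_div_le_sum_sq (r := k + 1) (by omega) (fun i => ∑ v with p v = i, y v)
    (by rw [sum_fiberwise, hy1])
  linarith

end Main

theorem stmt_8 {W : Type*} (r a : ℕ) (hr : 2 ≤ r) (F : SimpleGraph W) (h : HypStar r a F) :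
    ∀ ε : ℝ, 0 < ε → ∃ n₀ : ℕ, ∀ n ≥ n₀, ∀ G : SimpleGraph (Fin n), SpecExtremal F G →
      (eCnt (turanGraph n r) : ℝ) - ε * n ^ 2 ≤ eCnt G ∧
      ∀ p : Fin n → Fin r, (∀ q : Fin n → Fin r, crossCnt G q ≤ crossCnt G p) →
        (∑ i : Fin r, (inCnt G p i : ℝ)) ≤ ε * n ^ 2 ∧
        ∀ i : Fin r, (1 / (r : ℝ) - 3 * Real.sqrt ε) * n < partSize p i ∧
          (partSize p i : ℝ) < (1 / (r : ℝ) + 3 * Real.sqrt ε) * n := by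
  classical
  intro ε hε
  obtain ⟨_, hcol⟩ := finite_and_colorable_of_hypStar (by omega) h
  obtain ⟨η, hη, hηε, hη8⟩ : ∃ η : ℝ, 0 < η ∧ η ≤ ε / 8 ∧ η ≤ 1 / 8 :=
    ⟨min (ε / 8) (1 / 8), by positivity, min_le_left _ _, min_le_right _ _⟩
  obtain ⟨n₁, H₁⟩ := exists_partition_of_FFree (by omega) hcol hη
  obtain ⟨n₂, H₂⟩ := specRad_ge_of_specExtremal hr h
  refine ⟨n₁ + n₂ + ⌈r ^ 2 / η⌉₊ + 1, fun n hn G hG => ?_⟩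
  have hn1 : (1 : ℝ) ≤ n := by exact_mod_cast (by omega)
  have hnpos : (0 : ℝ) < n := by linarith
  have hnr : (r : ℝ) ^ 2 / η ≤ n := (Nat.le_ceil _).trans (Nat.cast_le.2 (by omega))
  have : Nonempty (Fin n) := ⟨⟨0, by omega⟩⟩
  have hr2 : (2 : ℝ) ≤ r := by exact_mod_cast hr
  have hrpos : (0 : ℝ) < r := by linarith
  have hrinv : 1 / (r : ℝ) ≤ 1 / 2 := one_div_le_one_div_of_le (by norm_num) hr2
  have hrinv0 : 0 < 1 / (r : ℝ) := by positivity
  have hrr : (1 / (r : ℝ)) * r = 1 := by field_simp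
  set s : ℝ := 1 - 1 / r with hs
  have hsr : s * r = r - 1 := by rw [hs, sub_mul, hrr, one_mul]
  -- The spectral radius is almost `s * n`.
  have hlam : (s - η) * n ≤ specRad G := by
    have h1 := H₂ n (by omega) G hG
    have h2 := le_two_mul_eCnt_turanGraph n (r := r) (by omega)
    rw [div_le_iff₀ hη] at hnr
    have h3 : r * ((s - η) * n * n) ≤ r * (specRad G * n) := by
      have h4 := mul_le_mul_of_nonneg_left h1 hrpos.le
      have h5 : (r : ℝ) ^ 2 ≤ η * n * n := by nlinarith [mul_pos hη hnpos]
      have h6 : r * ((s - η) * n * n) = (r - 1) * (n : ℝ) ^ 2 - r * (η * n * n) := by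
        rw [← hsr]; ring
      have h7 := mul_le_mul_of_nonneg_left h5 hrpos.le
      nlinarith
    exact le_of_mul_le_mul_right (le_of_mul_le_mul_left h3 hrpos) hnpos
  have hsη : 1 / 3 ≤ s - η := by linarith
  have hlam3 : 1 / 3 * n ≤ specRad G := (mul_le_mul_of_nonneg_right hsη hnpos.le).trans hlam
  have hlampos : 0 < specRad G := lt_of_lt_of_le (by positivity) hlam3
  -- The number of edges.
  have hedges : (s - 3 * η) * n ^ 2 ≤ 2 * eCnt G := by
    obtain ⟨y, hy, hy1, hyn, hysq⟩ := exists_weight_specRad_sq_le G hlampos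
    rw [Fintype.card_fin] at hyn
    obtain ⟨p, hp⟩ := H₁ n (by omega) G hG.1 y hy hy1 fun v => (hyn v).trans (by
      rw [div_le_div_iff₀ (by positivity) hnpos]
      nlinarith)
    have hE : edgeWeight G y Finset.univ Finset.univ ≤ s + η :=
      (le_add_of_nonneg_right (Finset.sum_nonneg fun i _ => edgeWeight_nonneg G hy _ _)).trans hp
    rw [← two_mul_eCnt] at hysq
    have h1 : ((s - η) * n) ^ 2 ≤ specRad G ^ 2 := by gcongr
    have h2 : 2 * (eCnt G : ℝ) * edgeWeight G y Finset.univ Finset.univ ≤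
        2 * (eCnt G : ℝ) * (s + η) := by gcongr
    have h3 : (s - 3 * η) * n ^ 2 * (s + η) ≤ 2 * (eCnt G : ℝ) * (s + η) := by
      nlinarith [sq_nonneg (η * n)]
    exact le_of_mul_le_mul_right h3 (by linarith)
  have hn2 : (0 : ℝ) < (n : ℝ) ^ 2 := by positivity
  have hηn : η * n ^ 2 ≤ ε / 8 * n ^ 2 := by gcongr
  refine ⟨?_, fun p hp => ?_⟩
  · have h1 := two_mul_eCnt_turanGraph_le n (r := r) (by omega)
    rw [← hsr] at h1
    have h2 : 2 * (eCnt (turanGraph n r) : ℝ) ≤ s * n ^ 2 :=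
      le_of_mul_le_mul_left (by linarith) hrpos
    nlinarith
  -- The uniform weight yields a partition with few edges inside the parts.
  obtain ⟨q, hq⟩ := H₁ n (by omega) G hG.1 (fun _ => 1 / n) (fun _ => by positivity)
    (by simp [hnpos.ne']) (fun _ => by gcongr; norm_num)
  have hscale : ∀ S T, edgeWeight G (fun _ => 1 / (n : ℝ)) S T * n ^ 2 =
      ∑ u ∈ S, ∑ v ∈ T, if G.Adj u v then (1 : ℝ) else 0 := fun S T => by
    rw [edgeWeight, Finset.sum_mul]
    refine Finset.sum_congr rfl fun u _ => ?_
    rw [Finset.sum_mul]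
    refine Finset.sum_congr rfl fun v _ => ?_
    split_ifs
    · field_simp
    · simp
  have hin : ∀ i, edgeWeight G (fun _ => 1 / (n : ℝ)) {v | q v = i} {v | q v = i} * n ^ 2 =
      2 * (inCnt G q i : ℝ) := fun i => by
    rw [hscale, two_mul_inCnt, Finset.sum_filter]
    refine Finset.sum_congr rfl fun u _ => ?_
    rw [Finset.sum_filter]
    by_cases hu : q u = i
    · simp only [hu, if_true, true_and]
      exact Finset.sum_congr rfl fun v _ => by
        by_cases h1 : G.Adj u v <;> by_cases h2 : q v = i <;> simp [h1, h2]
    · simp [hu]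
  have hqn := mul_le_mul_of_nonneg_right hq hn2.le
  rw [add_mul, Finset.sum_mul, hscale, ← two_mul_eCnt, Finset.sum_congr rfl fun i _ => hin i,
    ← Finset.mul_sum] at hqn
  have hqin : ∑ i, (inCnt G q i : ℝ) ≤ 2 * η * n ^ 2 := by linarith
  have hpin : ∑ i, (inCnt G p i : ℝ) ≤ 2 * η * n ^ 2 := by
    have h1 := crossCnt_add_sum_inCnt G p
    have h2 := crossCnt_add_sum_inCnt G q
    have h3 : (crossCnt G q : ℝ) ≤ crossCnt G p := by exact_mod_cast hp q
    linarith
  refine ⟨by linarith [mul_pos hε hn2], fun i => ?_⟩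
  have hsq : ∑ i, (partSize p i : ℝ) ^ 2 ≤ (1 / r + 7 * η) * n ^ 2 := by
    have h1 := crossCnt_add_sum_inCnt G p
    have h2 := two_mul_crossCnt_le G p
    have h3 : s * (n : ℝ) ^ 2 = n ^ 2 - 1 / r * n ^ 2 := by rw [hs]; ring
    linarith
  have hvar : ∑ i, ((partSize p i : ℝ) - 1 / r * n) ^ 2 ≤ 7 * η * n ^ 2 := by
    have h1 : ∑ i, ((partSize p i : ℝ) - 1 / r * n) ^ 2 =
        ∑ i, (partSize p i : ℝ) ^ 2 - 1 / r * n ^ 2 := by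
      simp_rw [sub_sq]
      rw [Finset.sum_add_distrib, Finset.sum_sub_distrib, ← Finset.sum_mul, ← Finset.mul_sum,
        sum_partSize]
      simp only [Finset.sum_const, Finset.card_univ, Fintype.card_fin, nsmul_eq_mul]
      field_simp
      ring
    linarith
  have hi : ((partSize p i : ℝ) - 1 / r * n) ^ 2 < (3 * Real.sqrt ε * n) ^ 2 := by
    have h1 := Finset.single_le_sum
      (f := fun i => ((partSize p i : ℝ) - 1 / r * n) ^ 2) (fun i _ => sq_nonneg _)
      (Finset.mem_univ i)
    have h2 : (3 * Real.sqrt ε * n) ^ 2 = 9 * ε * n ^ 2 := by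
      rw [mul_pow, mul_pow, Real.sq_sqrt hε.le]; norm_num
    have h3 := mul_pos hε hn2
    linarith
  have habs := abs_lt_of_sq_lt_sq' hi (by positivity)
  constructor <;> linarith [habs.1, habs.2]
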